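/- Let a, b, c, d, e be complex numbers with Re(e) > 0 and Re(d+e-a-b-c) > 0 (and no denominator parameter a nonpositive integer). Then Σ_{m,n≥0} (a)_m(b)_m(c)_m (d-a)_n(d-b)_n(-c)_n / ((d)_{m+n}(e)_m(d+e-a-b-c)_n m! n!) = Γ(e)Γ(e+d-a-b-c) / (Γ(e-c)Γ(e+d-a-b)). -/

import Mathlib

open Complex Finset

/-- Pochhammer symbol `(a)_k = a(a+1)⋯(a+k-1)`. -/
noncomputable def poch (a : ℂ) (k : ℕ) : ℂ := ∏ i ∈ Finset.range k, (a + i)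

/-- `z` is not a nonpositive integer. -/
def notNonposInt (z : ℂ) : Prop := ∀ k : ℕ, z ≠ -(k : ℂ)

lemma poch_succ (a : ℂ) (k : ℕ) : poch a (k+1) = poch a k * (a + k) := by
  simp [poch, Finset.prod_range_succ]

lemma poch_zero (a : ℂ) : poch a 0 = 1 := by simp [poch]

lemma poch_succ' (a : ℂ) (k : ℕ) : poch a (k+1) = a * poch (a+1) k := by
  simp only [poch, Finset.prod_range_succ']
  rw [mul_comm]
  congr 1
  · simp
  · apply Finset.prod_congr rfl
    intro i _
    push_cast
    ring

lemma poch_ne_zero {a : ℂ} (h : notNonposInt a) (k : ℕ) : poch a k ≠ 0 := by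
  unfold poch
  rw [Finset.prod_ne_zero_iff]
  intro i _ h0
  exact h i (eq_neg_of_add_eq_zero_left h0)

lemma add_nat_ne {a : ℂ} (h : notNonposInt a) (k : ℕ) : a + k ≠ 0 := fun h0 =>
  h k (eq_neg_of_add_eq_zero_left h0)

lemma nni_of_re {a : ℂ} (h : 0 < a.re) : notNonposInt a := by
  intro k hk
  rw [hk] at h
  simp at h
  linarith [(Nat.cast_nonneg k : (0:ℝ) ≤ k)]

lemma poch_one (k : ℕ) : poch 1 k = (Nat.factorial k : ℂ) := by
  induction k with
  | zero => simp [poch]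
  | succ k ih => rw [poch_succ, ih, Nat.factorial_succ]; push_cast; ring

open Filter Topology

lemma poch_lim (a : ℂ) : Tendsto (fun n : ℕ => poch a (n+1) / ((n:ℂ)^a * (Nat.factorial n : ℂ))) atTop
    (𝓝 (Complex.Gamma a)⁻¹) := by
  by_cases h : notNonposInt a
  · have hG : Complex.Gamma a ≠ 0 := Complex.Gamma_ne_zero h
    have := (Complex.GammaSeq_tendsto_Gamma a).inv₀ hG
    refine this.congr ?_
    intro n
    simp [Complex.GammaSeq, poch]
  · unfold notNonposInt at h
    push Not at h
    obtain ⟨k, hk⟩ := h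
    rw [hk, Complex.Gamma_neg_nat_eq_zero, inv_zero]
    refine tendsto_const_nhds.congr' ?_
    filter_upwards [eventually_ge_atTop k] with n hn
    have : poch (-(k:ℂ)) (n+1) = 0 := by
      unfold poch
      apply Finset.prod_eq_zero (i := k)
      · simp; omega
      · simp
    simp [this]

/-- ratio of two over two, balanced -/
lemma ratio_lim (p q e s : ℂ) (he : notNonposInt e) (hs : notNonposInt s) (h : p + q = e + s) :
    Tendsto (fun n : ℕ => poch p n * poch q n / (poch e n * poch s n)) atTop
    (𝓝 (Complex.Gamma e * Complex.Gamma s / (Complex.Gamma p * Complex.Gamma q))) := by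
  rw [← tendsto_add_atTop_iff_nat 1]
  have hGe : (Complex.Gamma e)⁻¹ ≠ 0 := inv_ne_zero (Complex.Gamma_ne_zero he)
  have hGs : (Complex.Gamma s)⁻¹ ≠ 0 := inv_ne_zero (Complex.Gamma_ne_zero hs)
  have := ((poch_lim p).mul (poch_lim q)).div ((poch_lim e).mul (poch_lim s)) (mul_ne_zero hGe hGs)
  have e1 : (Complex.Gamma p)⁻¹ * (Complex.Gamma q)⁻¹ / ((Complex.Gamma e)⁻¹ * (Complex.Gamma s)⁻¹)
    = Complex.Gamma e * Complex.Gamma s / (Complex.Gamma p * Complex.Gamma q) := by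
    rw [← mul_inv, ← mul_inv, div_eq_mul_inv, inv_inv, div_eq_mul_inv, mul_comm]
  rw [e1] at this
  refine this.congr' ?_
  filter_upwards [eventually_ge_atTop 1] with n hn
  have hn0 : (n:ℂ) ≠ 0 := by exact_mod_cast (by omega : n ≠ 0)
  have hf : (Nat.factorial n : ℂ) ≠ 0 := by exact_mod_cast Nat.factorial_ne_zero n
  have hpw : (n:ℂ)^p * (n:ℂ)^q = (n:ℂ)^e * (n:ℂ)^s := by
    rw [← Complex.cpow_add _ _ hn0, ← Complex.cpow_add _ _ hn0, h]
  have h1 : (n:ℂ)^e ≠ 0 := by simp [Complex.cpow_eq_zero_iff, hn0]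
  have h2 : (n:ℂ)^s ≠ 0 := by simp [Complex.cpow_eq_zero_iff, hn0]
  have h3 : (n:ℂ)^p ≠ 0 := by simp [Complex.cpow_eq_zero_iff, hn0]
  have h4 : (n:ℂ)^q ≠ 0 := by simp [Complex.cpow_eq_zero_iff, hn0]
  have h5 := poch_ne_zero he (n+1)
  have h6 := poch_ne_zero hs (n+1)
  simp only [Pi.div_apply]
  rw [div_mul_div_comm, div_mul_div_comm]
  rw [mul_mul_mul_comm ((n:ℂ)^p), hpw, mul_mul_mul_comm ((n:ℂ)^e)]
  field_simp

noncomputable def PP (p q r d e : ℂ) (n : ℕ) : ℂ :=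
  poch p n * poch q n * poch r n / (poch d n * poch e n * (Nat.factorial n : ℂ))

lemma PP_bound (p q r d e : ℂ) (hd : notNonposInt d) (he : notNonposInt e) :
    ∃ C : ℝ, ∀ n : ℕ, 1 ≤ n → ‖PP p q r d e (n+1)‖ ≤ C * (n:ℝ) ^ (-((d+e-p-q-r).re + 1)) := by
  have h1 : notNonposInt 1 := nni_of_re (by simp)
  have hG {x : ℂ} (hx : notNonposInt x) : (Complex.Gamma x)⁻¹ ≠ 0 :=
    inv_ne_zero (Complex.Gamma_ne_zero hx)
  have := (((poch_lim p).mul (poch_lim q)).mul (poch_lim r)).div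
    (((poch_lim d).mul (poch_lim e)).mul (poch_lim 1))
    (mul_ne_zero (mul_ne_zero (hG hd) (hG he)) (hG h1))
  obtain ⟨C, hC⟩ := this.norm.bddAbove_range
  refine ⟨C, fun n hn => ?_⟩
  have hb := hC (Set.mem_range_self n)
  have hn0 : (n:ℂ) ≠ 0 := by exact_mod_cast (by omega : n ≠ 0)
  have hnp : 0 < (n:ℝ) := by exact_mod_cast (by omega : 0 < n)
  have hf : (Nat.factorial n : ℂ) ≠ 0 := by exact_mod_cast Nat.factorial_ne_zero n
  have hpw (x : ℂ) : (n:ℂ)^x ≠ 0 := by simp [Complex.cpow_eq_zero_iff, hn0]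
  have key : PP p q r d e (n+1) =
     (poch p (n+1) / ((n:ℂ)^p * (Nat.factorial n : ℂ)) * (poch q (n+1) / ((n:ℂ)^q * (Nat.factorial n : ℂ)))
       * (poch r (n+1) / ((n:ℂ)^r * (Nat.factorial n : ℂ)))) /
     (poch d (n+1) / ((n:ℂ)^d * (Nat.factorial n : ℂ)) * (poch e (n+1) / ((n:ℂ)^e * (Nat.factorial n : ℂ)))
       * (poch 1 (n+1) / ((n:ℂ)^(1:ℂ) * (Nat.factorial n : ℂ)))) * (n:ℂ) ^ (-(d+e-p-q-r+1)) := by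
    have e2 : (n:ℂ) ^ (-(d+e-p-q-r+1)) = (n:ℂ)^p * (n:ℂ)^q * (n:ℂ)^r / ((n:ℂ)^d * (n:ℂ)^e * (n:ℂ)^(1:ℂ)) := by
      rw [← Complex.cpow_add _ _ hn0, ← Complex.cpow_add _ _ hn0, ← Complex.cpow_add _ _ hn0,
        ← Complex.cpow_add _ _ hn0, ← Complex.cpow_sub _ _ hn0]
      congr 1; ring
    rw [e2, PP, ← poch_one]
    have h5 := poch_ne_zero hd (n+1)
    have h6 := poch_ne_zero he (n+1)
    have h7 := poch_ne_zero h1 (n+1)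
    have := hpw p
    have := hpw q
    have := hpw r
    have := hpw d
    have := hpw e
    have := hpw 1
    field_simp
  rw [key, norm_mul, Complex.norm_natCast_cpow_of_pos (by omega)]
  have : (-(d+e-p-q-r+1)).re = -((d+e-p-q-r).re + 1) := by simp
  rw [this]
  exact mul_le_mul_of_nonneg_right hb (Real.rpow_nonneg hnp.le _)

lemma PP_summable (p q r d e : ℂ) (hd : notNonposInt d) (he : notNonposInt e)
    (h : 0 < (d+e-p-q-r).re) : Summable (fun n => ‖PP p q r d e n‖) := by
  obtain ⟨C, hC⟩ := PP_bound p q r d e hd he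
  rw [← summable_nat_add_iff 2]
  have hs : Summable (fun n : ℕ => C * ((n:ℝ)) ^ (-((d+e-p-q-r).re + 1))) := by
    apply Summable.mul_left
    rw [Real.summable_nat_rpow]
    linarith
  rw [← summable_nat_add_iff 1] at hs
  refine Summable.of_nonneg_of_le (fun _ => norm_nonneg _) (fun n => ?_) hs
  exact hC (n+1) (by omega)

lemma PP_tendsto (p q r d e : ℂ) (hd : notNonposInt d) (he : notNonposInt e)
    (h : 0 < (d+e-p-q-r).re) : Tendsto (fun n : ℕ => (n:ℝ) * ‖PP p q r d e n‖) atTop (𝓝 0) := by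
  obtain ⟨C, hC⟩ := PP_bound p q r d e hd he
  rw [← tendsto_add_atTop_iff_nat 1]
  have h1 : Tendsto (fun n : ℕ => (2 * C) * (n:ℝ) ^ (-((d+e-p-q-r).re))) atTop (𝓝 0) := by
    have := ((tendsto_rpow_neg_atTop h).comp tendsto_natCast_atTop_atTop).const_mul (2*C)
    simpa using this
  refine squeeze_zero' (Eventually.of_forall fun n => by positivity) ?_ h1
  filter_upwards [eventually_ge_atTop 1] with n hn
  have hnp : 0 < (n:ℝ) := by exact_mod_cast (by omega : 0 < n)
  have hb := hC n hn
  have e1 : (n:ℝ) ^ (-((d+e-p-q-r).re)) = n * (n:ℝ) ^ (-((d+e-p-q-r).re + 1)) := by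
    rw [← Real.rpow_one_add' hnp.le]
    · congr 1; ring
    · intro h'; linarith
  have hn1 : ((n+1 : ℕ):ℝ) ≤ 2 * n := by
    push_cast
    have : (1:ℝ) ≤ n := by exact_mod_cast hn
    linarith
  calc ((n+1 : ℕ):ℝ) * ‖PP p q r d e (n+1)‖ ≤ (2 * n) * (C * (n:ℝ) ^ (-((d+e-p-q-r).re + 1))) :=
        mul_le_mul hn1 hb (norm_nonneg _) (by positivity)
    _ = _ := by rw [e1]; ring

lemma poch_add_bound (d : ℂ) (hd : notNonposInt d) :
    ∃ C : ℝ, 0 < C ∧ ∀ m n : ℕ, ‖poch d m * poch d n‖ ≤ C * ‖poch d (m+n)‖ := by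
  -- lower bound
  have hlow : ∃ δ : ℝ, 0 < δ ∧ ∀ k : ℕ, δ ≤ ‖d + k‖ := by
    have ht : Tendsto (fun k : ℕ => ‖d + k‖⁻¹) atTop (𝓝 0) := by
      apply Filter.Tendsto.inv_tendsto_atTop
      apply tendsto_atTop_mono (f := fun k : ℕ => (k:ℝ) + (-‖d‖))
      · intro k
        have := norm_sub_le (d + k) d
        simp at this
        linarith
      · exact tendsto_atTop_add_const_right _ _ tendsto_natCast_atTop_atTop
    obtain ⟨B, hB⟩ := ht.bddAbove_range
    have hp (k : ℕ) : 0 < ‖d + k‖ := norm_pos_iff.mpr (add_nat_ne hd k)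
    have hB0 : 0 < B := lt_of_lt_of_le (inv_pos.mpr (hp 0)) (hB (Set.mem_range_self 0))
    refine ⟨B⁻¹, inv_pos.mpr hB0, fun k => ?_⟩
    exact inv_le_of_inv_le₀ (hp k) (hB (Set.mem_range_self k))
  obtain ⟨δ, hδ, hlow⟩ := hlow
  obtain ⟨K, hK⟩ := exists_nat_ge (-d.re)
  set M : ℝ := max 1 ((‖d‖ + K) / δ) with hM
  have hM1 : 1 ≤ M := le_max_left _ _
  refine ⟨M ^ K, by positivity, fun m n => ?_⟩
  have step (i : ℕ) : ‖d + i‖ ≤ (if i < K then M else 1) * ‖d + (m + i : ℕ)‖ := by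
    split_ifs with hi
    · have : (‖d‖ + K) / δ ≤ M := le_max_right _ _
      calc ‖d + i‖ ≤ ‖d‖ + K := by
            refine (norm_add_le _ _).trans ?_
            have : (i:ℝ) ≤ K := by exact_mod_cast hi.le
            simpa using this
        _ = (‖d‖ + K) / δ * δ := by field_simp
        _ ≤ M * ‖d + (m + i : ℕ)‖ := mul_le_mul this (hlow _) hδ.le (by positivity)
    · rw [one_mul]
      have h1 : (K:ℝ) ≤ i := by exact_mod_cast (by omega : K ≤ i)
      have h0 : 0 ≤ (m:ℝ) := Nat.cast_nonneg m
      rw [Complex.norm_def, Complex.norm_def]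
      apply Real.sqrt_le_sqrt
      simp [Complex.normSq_apply]
      nlinarith
  have hsplit : ∀ n : ℕ, ‖poch d m * poch d n‖ ≤ M ^ (min n K) * ‖poch d (m+n)‖ := by
    intro n
    induction n with
    | zero => simp [poch_zero]
    | succ n ih =>
      rw [poch_succ, ← mul_assoc, norm_mul (poch d m * poch d n), ← add_assoc, poch_succ, norm_mul (poch d (m+n))]
      have := step n
      calc _ ≤ (M ^ (min n K) * ‖poch d (m+n)‖) * ((if n < K then M else 1) * ‖d + (m + n : ℕ)‖) :=
            mul_le_mul ih this (norm_nonneg _) (by positivity)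
        _ = (M ^ (min n K) * (if n < K then M else 1)) * (‖poch d (m+n)‖ * ‖d + (m + n : ℕ)‖) := by ring
        _ = _ := by
            congr 1
            split_ifs with h
            · rw [← pow_succ]; congr 1; omega
            · rw [mul_one]; congr 1; omega
  refine (hsplit n).trans ?_
  apply mul_le_mul_of_nonneg_right _ (norm_nonneg _)
  exact pow_le_pow_right₀ hM1 (min_le_right _ _)

noncomputable def TT (a b c d e s : ℂ) (m n : ℕ) : ℂ :=
  poch a m * poch b m * poch c m * poch (d - a) n * poch (d - b) n * poch (-c) n /
          (poch d (m + n) * poch e m * poch s n *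
            (Nat.factorial m : ℂ) * (Nat.factorial n : ℂ))

lemma TT_bound (a b c d : ℂ) (hd : notNonposInt d) :
    ∃ C : ℝ, 0 < C ∧ ∀ e s : ℂ, notNonposInt e → notNonposInt s → ∀ m n : ℕ,
      ‖TT a b c d e s m n‖ ≤ C * (‖PP a b c d e m‖ * ‖PP (d-a) (d-b) (-c) d s n‖) := by
  obtain ⟨C, hC, h⟩ := poch_add_bound d hd
  refine ⟨C, hC, fun e s he hs m n => ?_⟩
  have h1 := poch_ne_zero hd m
  have h2 := poch_ne_zero hd n
  have h3 := poch_ne_zero hd (m+n)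
  have h4 := poch_ne_zero he m
  have h5 := poch_ne_zero hs n
  have hf : (Nat.factorial n : ℂ) ≠ 0 := by exact_mod_cast Nat.factorial_ne_zero n
  have hf' : (Nat.factorial m : ℂ) ≠ 0 := by exact_mod_cast Nat.factorial_ne_zero m
  have e1 : TT a b c d e s m n = (poch d m * poch d n / poch d (m+n)) *
      (PP a b c d e m * PP (d-a) (d-b) (-c) d s n) := by
    unfold TT PP
    field_simp
  rw [e1, norm_mul, norm_mul (PP a b c d e m)]
  apply mul_le_mul_of_nonneg_right _ (by positivity)
  rw [norm_div, div_le_iff₀ (norm_pos_iff.mpr h3)]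
  exact h m n

lemma TT_summable (a b c d e s : ℂ) (hd : notNonposInt d) (he : 0 < e.re) (hs : 0 < s.re)
    (h : s = d + e - a - b - c) :
    Summable (fun p : ℕ × ℕ => ‖TT a b c d e s p.1 p.2‖) := by
  obtain ⟨C, hC, hb⟩ := TT_bound a b c d hd
  have he' := nni_of_re he
  have hs' := nni_of_re hs
  refine Summable.of_nonneg_of_le (fun _ => norm_nonneg _) (fun p => hb e s he' hs' p.1 p.2) ?_
  apply Summable.mul_left
  apply Summable.mul_of_nonneg (PP_summable a b c d e hd he' (by rw [← h]; exact hs))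
    (PP_summable (d-a) (d-b) (-c) d s hd hs' ?_) (fun _ => norm_nonneg _) (fun _ => norm_nonneg _)
  have : d + s - (d-a) - (d-b) - (-c) = e := by rw [h]; ring
  rw [this]; exact he

noncomputable def GG (a b c d e s : ℂ) (m n : ℕ) : ℂ := m * ((n - c) / (n + s)) * TT a b c d e s m n
noncomputable def HH (a b c d e s : ℂ) (m n : ℕ) : ℂ := n * ((m + c) / (m + e)) * TT a b c d e s m n

lemma TT_cert (a b c d e s : ℂ) (hd : notNonposInt d) (he : notNonposInt e) (hs : notNonposInt s)
    (h : s = d + e - a - b - c) (m n : ℕ) :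
    c * (TT a b c d e s m n - (e-c)*(s+c)/(e*s) * TT a b c d (e+1) (s+1) m n) =
     (GG a b c d e s (m+1) n - GG a b c d e s m n) - (HH a b c d e s m (n+1) - HH a b c d e s m n) := by
  have he0 : e ≠ 0 := by simpa using add_nat_ne he 0
  have hs0 : s ≠ 0 := by simpa using add_nat_ne hs 0
  have hem := add_nat_ne he m
  have hsn := add_nat_ne hs n
  have hem1 := add_nat_ne he (m+1)
  have hsn1 := add_nat_ne hs (n+1)
  have hdm := add_nat_ne hd (m+n)
  have h3 := poch_ne_zero hd (m+n)
  have h4 := poch_ne_zero he m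
  have h5 := poch_ne_zero hs n
  have hm1 : (m:ℂ) + 1 ≠ 0 := by exact_mod_cast (by omega : m + 1 ≠ 0)
  have hn1 : (n:ℂ) + 1 ≠ 0 := by exact_mod_cast (by omega : n + 1 ≠ 0)
  have hf : (Nat.factorial n : ℂ) ≠ 0 := by exact_mod_cast Nat.factorial_ne_zero n
  have hf' : (Nat.factorial m : ℂ) ≠ 0 := by exact_mod_cast Nat.factorial_ne_zero m
  have e1 : TT a b c d (e+1) (s+1) m n = e * s / ((e+m)*(s+n)) * TT a b c d e s m n := by
    have q1 : poch (e+1) m = poch e m * (e+m) / e := by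
      rw [← poch_succ, poch_succ']; field_simp
    have q2 : poch (s+1) n = poch s n * (s+n) / s := by
      rw [← poch_succ, poch_succ']; field_simp
    unfold TT
    rw [q1, q2]
    field_simp
  have e2 : TT a b c d e s (m+1) n = (a+m)*(b+m)*(c+m)/((d+(m+n:ℕ))*(e+m)*(m+1)) * TT a b c d e s m n := by
    unfold TT
    rw [show m+1+n = (m+n)+1 by ring]
    simp only [poch_succ, Nat.factorial_succ]
    push_cast at hdm ⊢
    field_simp
  have e3 : TT a b c d e s m (n+1) = (d-a+n)*(d-b+n)*(-c+n)/((d+(m+n:ℕ))*(s+n)*(n+1)) * TT a b c d e s m n := by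
    unfold TT
    rw [show m+(n+1) = (m+n)+1 by ring]
    simp only [poch_succ, Nat.factorial_succ]
    push_cast at hdm ⊢
    field_simp
  unfold GG HH
  rw [e1, e2, e3]
  generalize TT a b c d e s m n = t
  push_cast at *
  have hem' : (m:ℂ) + e ≠ 0 := by rwa [add_comm]
  have hsn' : (n:ℂ) + s ≠ 0 := by rwa [add_comm]
  have key : (a+m)*(b+m) - (d-a+n)*(d-b+n) = (d+(m+n))*(a+b-d+m-n) := by ring
  have k2 : ((a+m)*(b+m)/(d+(m+n)) - (d-a+n)*(d-b+n)/(d+(m+n))) = (a+b-d+m-n) := by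
    rw [← sub_div, key]; field_simp
  have lhs : c * (t - (e-c)*(s+c)/(e*s) * (e*s/((e+m)*(s+n)) * t)) =
     c * ((e+m)*(s+n) - (e-c)*(s+c)) / ((e+m)*(s+n)) * t := by
    field_simp
  have rhs : ((m+1) * ((n-c)/(n+s)) * ((a+m)*(b+m)*(c+m)/((d+(m+n))*(e+m)*(m+1)) * t)
      - m * ((n-c)/(n+s)) * t) - ((n+1) * ((m+c)/(m+e)) *
        ((d-a+n)*(d-b+n)*(-c+n)/((d+(m+n))*(s+n)*(n+1)) * t) - n * ((m+c)/(m+e))*t) =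
      (((a+m)*(b+m)/(d+(m+n)) - (d-a+n)*(d-b+n)/(d+(m+n))) * ((n-c)*(m+c))
        - m*(n-c)*(e+m) + n * (m+c)*(s+n)) / ((e+m)*(s+n)) * t := by
    rw [add_comm (n:ℂ) s, add_comm (m:ℂ) e]
    field_simp
    ring
  rw [lhs, rhs, k2, h]
  congr 2
  ring

lemma frac_bound (c s : ℂ) (hs : 0 < s.re) (n : ℕ) : ‖((n:ℂ) - c)/(n+s)‖ ≤ 1 + ‖s+c‖/s.re := by
  have h1 : s.re ≤ ‖(n:ℂ)+s‖ := by
    refine le_trans ?_ (Complex.re_le_norm _)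
    simp
  have h0 : 0 < ‖(n:ℂ)+s‖ := lt_of_lt_of_le hs h1
  have hne : (n:ℂ)+s ≠ 0 := norm_pos_iff.mp h0
  have : ((n:ℂ) - c)/(n+s) = 1 - (s+c)/(n+s) := by field_simp; ring
  rw [this]
  refine (norm_sub_le _ _).trans ?_
  rw [norm_one, norm_div]
  gcongr

lemma edge_tendsto (u v : ℕ → ℝ) (hv : Summable v) (hv0 : ∀ n, 0 ≤ v n) (hu0 : ∀ n, 0 ≤ u n)
    (hu : Tendsto (fun n : ℕ => (n:ℝ) * u n) atTop (𝓝 0)) (K : ℝ) (hK : 0 ≤ K)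
    (g : ℕ → ℕ → ℂ) (hg : ∀ m n, ‖g m n‖ ≤ K * (((m:ℝ) * u m) * v n)) :
    Tendsto (fun M : ℕ => ∑ n ∈ Finset.range M, g M n) atTop (𝓝 0) := by
  have h1 : Tendsto (fun M : ℕ => K * (((M:ℝ) * u M) * ∑' n, v n)) atTop (𝓝 0) := by
    simpa using (hu.mul_const (∑' n, v n)).const_mul K
  refine squeeze_zero_norm (fun M => ?_) h1
  refine (norm_sum_le _ _).trans ?_
  refine (Finset.sum_le_sum fun n _ => hg M n).trans ?_
  rw [← Finset.mul_sum, ← Finset.mul_sum]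
  have := hu0 M
  gcongr
  exact hv.sum_le_tsum _ (fun n _ => hv0 n)

lemma TT_rec (a b c d e s : ℂ) (hc : c ≠ 0) (hd : notNonposInt d) (he : 0 < e.re) (hs : 0 < s.re)
    (h : s = d + e - a - b - c) :
    ∑' p : ℕ × ℕ, TT a b c d e s p.1 p.2 =
      (e-c)*(s+c)/(e*s) * ∑' p : ℕ × ℕ, TT a b c d (e+1) (s+1) p.1 p.2 := by
  have he' := nni_of_re he
  have hs' := nni_of_re hs
  have S1 := (TT_summable a b c d e s hd he hs h).of_norm
  have S2 := (TT_summable a b c d (e+1) (s+1) hd (by simp; linarith) (by simp; linarith)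
    (by rw [h]; ring)).of_norm
  have hsum := ((S1.hasSum.sub (S2.hasSum.mul_left ((e-c)*(s+c)/(e*s)))).mul_left c)
  have hsq : Tendsto (fun M : ℕ => Finset.range M ×ˢ Finset.range M) atTop atTop :=
    Filter.tendsto_atTop_finset_of_monotone
      (fun i j hij => Finset.product_subset_product (Finset.range_mono hij) (Finset.range_mono hij))
      (fun p => ⟨p.1 + p.2 + 1, by simp⟩)
  have hl := hsum.comp hsq
  obtain ⟨C, hC, hb⟩ := TT_bound a b c d hd
  have hb := hb e s he' hs'
  have Su := PP_summable a b c d e hd he' (by rw [← h]; exact hs)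
  have tu := PP_tendsto a b c d e hd he' (by rw [← h]; exact hs)
  have h' : d + s - (d-a) - (d-b) - (-c) = e := by rw [h]; ring
  have Sv := PP_summable (d-a) (d-b) (-c) d s hd hs' (by rw [h']; exact he)
  have tv := PP_tendsto (d-a) (d-b) (-c) d s hd hs' (by rw [h']; exact he)
  have tG := edge_tendsto _ _ Sv (fun _ => norm_nonneg _) (fun _ => norm_nonneg _) tu
    ((1 + ‖s+c‖/s.re) * C) (by positivity) (fun m n => GG a b c d e s m n) (by
      intro m n
      unfold GG
      rw [norm_mul, norm_mul, Complex.norm_natCast]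
      calc _ ≤ (m:ℝ) * (1 + ‖s+c‖/s.re) * (C * (‖PP a b c d e m‖ * ‖PP (d-a) (d-b) (-c) d s n‖)) := by
            gcongr
            · exact frac_bound c s hs n
            · exact hb m n
        _ = _ := by ring)
  have tH := edge_tendsto _ _ Su (fun _ => norm_nonneg _) (fun _ => norm_nonneg _) tv
    ((1 + ‖e+(-c)‖/e.re) * C) (by positivity) (fun n m => HH a b c d e s m n) (by
      intro n m
      unfold HH
      rw [norm_mul, norm_mul, Complex.norm_natCast]
      calc _ ≤ (n:ℝ) * (1 + ‖e+(-c)‖/e.re) * (C * (‖PP a b c d e m‖ * ‖PP (d-a) (d-b) (-c) d s n‖)) := by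
            gcongr
            · simpa using frac_bound (-c) e he m
            · exact hb m n
        _ = _ := by ring)
  have h0 := tG.sub tH
  have heq : ∀ M : ℕ, (∑ n ∈ Finset.range M, GG a b c d e s M n) - (∑ m ∈ Finset.range M, HH a b c d e s m M)
     = ∑ p ∈ Finset.range M ×ˢ Finset.range M, c * (TT a b c d e s p.1 p.2 - (e-c)*(s+c)/(e*s) * TT a b c d (e+1) (s+1) p.1 p.2) := by
    intro M
    rw [Finset.sum_congr (s₁ := Finset.range M ×ˢ Finset.range M) rfl (fun p _ => TT_cert a b c d e s hd he' hs' h p.1 p.2)]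
    rw [Finset.sum_sub_distrib]
    congr 1
    · rw [Finset.sum_product_right]
      refine Finset.sum_congr rfl fun n _ => ?_
      rw [Finset.sum_range_sub (fun m => GG a b c d e s m n)]
      simp [GG]
    · rw [Finset.sum_product]
      refine Finset.sum_congr rfl fun m _ => ?_
      rw [Finset.sum_range_sub (fun n => HH a b c d e s m n)]
      simp [HH]
  have h1 := h0.congr heq
  have := tendsto_nhds_unique hl h1
  rw [sub_zero, mul_eq_zero] at this
  exact sub_eq_zero.mp (this.resolve_left hc)

lemma TT_iter (a b c d e s : ℂ) (hc : c ≠ 0) (hd : notNonposInt d) (he : 0 < e.re) (hs : 0 < s.re)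
    (h : s = d + e - a - b - c) (k : ℕ) :
    ∑' p : ℕ × ℕ, TT a b c d e s p.1 p.2 =
      poch (e-c) k * poch (s+c) k/(poch e k * poch s k) *
        ∑' p : ℕ × ℕ, TT a b c d (e+k) (s+k) p.1 p.2 := by
  induction k with
  | zero => simp [poch_zero]
  | succ k ih =>
    rw [ih, TT_rec a b c d (e+k) (s+k) hc hd (by simp; positivity) (by simp; positivity) (by rw [h]; ring)]
    rw [← mul_assoc]
    simp only [poch_succ]
    push_cast
    rw [add_assoc e, add_assoc s (k:ℂ) 1]
    congr 1
    rw [div_mul_div_comm]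
    congr 1 <;> ring

lemma poch_mono (e : ℂ) (he : 0 < e.re) (k m : ℕ) : ‖poch e m‖ ≤ ‖poch (e+k) m‖ := by
  unfold poch
  rw [norm_prod, norm_prod]
  refine Finset.prod_le_prod (fun _ _ => norm_nonneg _) (fun i _ => ?_)
  rw [Complex.norm_def, Complex.norm_def]
  apply Real.sqrt_le_sqrt
  simp [Complex.normSq_apply]
  have h1 : 0 ≤ (k:ℝ) := Nat.cast_nonneg k
  have h2 : 0 ≤ (i:ℝ) := Nat.cast_nonneg i
  nlinarith

lemma poch_shift_tendsto (e : ℂ) (m : ℕ) (hm : m ≠ 0) :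
    Tendsto (fun k : ℕ => (poch (e+k) m)⁻¹) atTop (𝓝 0) := by
  have h1 (x : ℂ) : Tendsto (fun k : ℕ => (x + k)⁻¹) atTop (𝓝 0) := by
    apply tendsto_inv₀_cobounded.comp
    rw [← tendsto_norm_atTop_iff_cobounded]
    apply tendsto_atTop_mono (f := fun k : ℕ => (k:ℝ) + (-‖x‖))
    · intro k
      have := norm_sub_le (x + k) x
      simp at this
      linarith
    · exact tendsto_atTop_add_const_right _ _ tendsto_natCast_atTop_atTop
  have := tendsto_finsetProd (Finset.range m) (fun i _ => h1 (e+i))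
  rw [Finset.prod_const, Finset.card_range, zero_pow hm] at this
  refine this.congr fun k => ?_
  unfold poch
  rw [← Finset.prod_inv_distrib]
  refine Finset.prod_congr rfl fun i _ => ?_
  congr 1; ring

lemma TT_lim (a b c d e s : ℂ) (hd : notNonposInt d) (he : 0 < e.re) (hs : 0 < s.re)
    (h : s = d + e - a - b - c) :
    Tendsto (fun k : ℕ => ∑' p : ℕ × ℕ, TT a b c d (e+k) (s+k) p.1 p.2) atTop (𝓝 1) := by
  have he' := nni_of_re he
  have hs' := nni_of_re hs
  have hform (e s : ℂ) (m n : ℕ) : TT a b c d e s m n =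
    (poch a m * poch b m * poch c m * poch (d - a) n * poch (d - b) n * poch (-c) n /
          (poch d (m + n) * (Nat.factorial m : ℂ) * (Nat.factorial n : ℂ))) * ((poch e m)⁻¹ * (poch s n)⁻¹) := by
    unfold TT
    rw [← mul_inv, ← div_eq_mul_inv, div_div]
    congr 1; ring
  have hdom (e : ℂ) (he : 0 < e.re) (k m : ℕ) : ‖(poch (e+k) m)⁻¹‖ ≤ ‖(poch e m)⁻¹‖ := by
    rw [norm_inv, norm_inv]
    exact inv_anti₀ (norm_pos_iff.mpr (poch_ne_zero (nni_of_re he) m)) (poch_mono e he k m)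
  have := tendsto_tsum_of_dominated_convergence (𝓕 := atTop)
    (f := fun (k : ℕ) (p : ℕ × ℕ) => TT a b c d (e+k) (s+k) p.1 p.2)
    (g := fun p => if p = (0,0) then 1 else 0)
    (TT_summable a b c d e s hd he hs h) ?_ ?_
  · simpa using this
  · rintro ⟨m, n⟩
    by_cases h0 : m = 0
    · by_cases h1 : n = 0
      · subst h0 h1
        simp [TT, poch_zero]
      · simp only [hform, Prod.mk.injEq, h1, and_false, if_false]
        subst h0
        simp only [poch_zero]
        simpa using (poch_shift_tendsto s n h1).const_mul _
    · simp only [hform, Prod.mk.injEq, h0, false_and, if_false]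
      rw [← mul_zero]
      refine Tendsto.const_mul _ ?_
      refine squeeze_zero_norm (a := fun k : ℕ => ‖(poch (e+k) m)⁻¹‖ * ‖(poch s n)⁻¹‖) (fun k => ?_) ?_
      · rw [norm_mul]
        gcongr
        exact hdom s hs k n
      · simpa using (poch_shift_tendsto e m h0).norm.mul_const ‖(poch s n)⁻¹‖
  · refine Eventually.of_forall fun k p => ?_
    rw [hform, hform e, norm_mul, norm_mul, norm_mul, norm_mul]
    gcongr
    · exact hdom e he k _
    · exact hdom s hs k _

theorem kdf_summation_res1 (a b c d e : ℂ)
    (h1 : 0 < e.re) (h2 : 0 < (d + e - a - b - c).re)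
    (hd : notNonposInt d) (he : notNonposInt e)
    (hee : notNonposInt (d + e - a - b - c)) :
    (∑' (m : ℕ) (n : ℕ),
        poch a m * poch b m * poch c m * poch (d - a) n * poch (d - b) n * poch (-c) n /
          (poch d (m + n) * poch e m * poch (d + e - a - b - c) n *
            (Nat.factorial m : ℂ) * (Nat.factorial n : ℂ))) =
      Complex.Gamma e * Complex.Gamma (e + d - a - b - c) /
        (Complex.Gamma (e - c) * Complex.Gamma (e + d - a - b)) := by
  obtain ⟨s, hs⟩ : ∃ s, s = d + e - a - b - c := ⟨_, rfl⟩
  have r1 : e + d - a - b - c = s := by rw [hs]; ring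
  have r2 : e + d - a - b = s + c := by rw [hs]; ring
  rw [r1, r2]
  rw [← hs] at h2 hee ⊢
  have hS := (TT_summable a b c d e s hd h1 h2 hs).of_norm
  have hT : (∑' (m : ℕ) (n : ℕ),
        poch a m * poch b m * poch c m * poch (d - a) n * poch (d - b) n * poch (-c) n /
          (poch d (m + n) * poch e m * poch s n *
            (Nat.factorial m : ℂ) * (Nat.factorial n : ℂ))) = ∑' p : ℕ × ℕ, TT a b c d e s p.1 p.2 :=
    (hS.tsum_prod).symm
  rw [hT]
  by_cases hc : c = 0
  · subst hc
    have g1 := Complex.Gamma_ne_zero he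
    have g2 := Complex.Gamma_ne_zero hee
    rw [tsum_eq_single (0,0)]
    · simp only [sub_zero, add_zero, TT, poch_zero]
      rw [div_self (mul_ne_zero g1 g2)]
      simp
    · rintro ⟨m, n⟩ hmn
      rcases m with _ | m
      · rcases n with _ | n
        · simp at hmn
        · simp [TT, poch_succ']
      · simp [TT, poch_succ']
  · have l1 := (ratio_lim (e-c) (s+c) e s he hee (by ring)).mul (TT_lim a b c d e s hd h1 h2 hs)
    rw [mul_one] at l1
    exact tendsto_nhds_unique (tendsto_const_nhds.congr (TT_iter a b c d e s hc hd h1 h2 hs)) l1
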